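/- Let $\alpha, \beta \in \mathbb{C} \setminus \{-1, 0, 1\}$ with $\beta \neq \pm\alpha$, and let $L^\alpha, L^\beta \subseteq W$ be null lines with $\rho L^\alpha \cap (L^\alpha)^\perp = \{0\}$ and $\rho L^\beta \cap (L^\beta)^\perp = \{0\}$. Set $\hat{L} := p_{\alpha,L^\alpha}(\beta) L^\beta$ and $\tilde{L} := q_{\beta,L^\beta}(\alpha) L^\alpha$, and suppose $\rho \hat{L} \cap \hat{L}^\perp = \{0\}$ and $\rho \tilde{L} \cap \tilde{L}^\perp = \{0\}$. Define $K := q_{\beta,L^\beta}(0) \circ q_{\beta,\hat{L}}(0)$. Then for every $\lambda \in \mathbb{C} \setminus \{\alpha, -\alpha, \beta, -\beta\}$ one has $p_{\alpha,\tilde{L}}(\lambda) \circ q_{\beta,L^\beta}(\lambda) = K \circ q_{\beta,\hat{L}}(\lambda) \circ p_{\alpha,L^\alpha}(\lambda)$. Moreover $\rho \circ K \circ \rho = K$, so $K$ preserves the eigenspaces $\ker(\rho - \mathrm{id})$ and $\ker(\rho + \mathrm{id})$. -/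

import Mathlib

open Module

set_option linter.unusedSimpArgs false

/-- `ActsAs B ρ L a b T` says that the endomorphism `T` acts as multiplication
by `a` on `L`, as the identity on `(L ⊕ ρL)^⊥`, and as multiplication by `b` on `ρL`.
This is the defining property of the maps `p_{α,L}(λ)` and `q_{α,L}(λ)`. -/
def ActsAs {W : Type*} [AddCommGroup W] [Module ℂ W]
    (B : LinearMap.BilinForm ℂ W) (ρ : Module.End ℂ W) (L : Submodule ℂ W)
    (a b : ℂ) (T : Module.End ℂ W) : Prop :=
  (∀ x ∈ L, T x = a • x) ∧
  (∀ x ∈ B.orthogonal (L ⊔ Submodule.map ρ L), T x = x) ∧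
  (∀ x ∈ Submodule.map ρ L, T x = b • x)

/-- Explicit formula for a map as in `ActsAs`. -/
theorem ActsAs.formula {W : Type*} [AddCommGroup W] [Module ℂ W]
    {B : LinearMap.BilinForm ℂ W} (hB : ∀ x y, B x y = B y x)
    {ρ : Module.End ℂ W} (hρB : ∀ x y, B (ρ x) (ρ y) = B x y)
    {L : Submodule ℂ W} {l : W} (hL : L = Submodule.span ℂ {l}) (hnull : B l l = 0)
    {s : ℂ} (hs : B l (ρ l) = s) (hs0 : s ≠ 0)
    {a b : ℂ} {T : Module.End ℂ W} (h : ActsAs B ρ L a b T) (x : W) :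
    T x = x + ((a - 1) * B x (ρ l) / s) • l + ((b - 1) * B x l / s) • ρ l := by
  obtain ⟨h1, h2, h3⟩ := h
  have hl : l ∈ L := by rw [hL]; exact Submodule.mem_span_singleton_self l
  have e1 := h1 l hl
  have e3 := h3 (ρ l) (Submodule.mem_map_of_mem hl)
  have hs' : B (ρ l) l = s := by rw [hB]; exact hs
  have e2 := h2 (x - (B x (ρ l) / s) • l - (B x l / s) • ρ l) (by
    rw [LinearMap.BilinForm.mem_orthogonal_iff]
    intro n hn
    rw [hL, Submodule.map_span, Set.image_singleton] at hn
    obtain ⟨y, hy, z, hz, rfl⟩ := Submodule.mem_sup.1 hn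
    obtain ⟨c, rfl⟩ := Submodule.mem_span_singleton.1 hy
    obtain ⟨d, rfl⟩ := Submodule.mem_span_singleton.1 hz
    simp only [map_add, map_sub, map_smul, LinearMap.add_apply,
      LinearMap.smul_apply, smul_eq_mul, hρB, hs, hs', hnull, hB l x, hB (ρ l) x]
    field_simp
    ring)
  simp only [map_sub, map_smul, e1, e3] at e2
  have : T x = (x - (B x (ρ l) / s) • l - (B x l / s) • ρ l)
    + (B x (ρ l) / s) • a • l + (B x l / s) • b • ρ l := by
    rw [← e2]; abel
  rw [this]
  module

/-- A normalized generator of a null line. -/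
theorem exists_gen {W : Type*} [AddCommGroup W] [Module ℂ W]
    {B : LinearMap.BilinForm ℂ W} 
    {ρ : Module.End ℂ W} (hρ2 : ∀ x, ρ (ρ x) = x)
    {L : Submodule ℂ W} (h1 : Module.finrank ℂ L = 1)
    (hρ : Submodule.map ρ L ⊓ B.orthogonal L = ⊥) :
    ∃ l, L = Submodule.span ℂ {l} ∧ B l (ρ l) = 1 := by
  obtain ⟨v, hv0, hv⟩ := finrank_eq_one_iff'.1 h1
  have hL : L = Submodule.span ℂ {(v : W)} := by
    apply le_antisymm
    · intro w hw
      obtain ⟨c, hc⟩ := hv ⟨w, hw⟩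
      exact Submodule.mem_span_singleton.2 ⟨c, congrArg Subtype.val hc⟩
    · rw [Submodule.span_singleton_le_iff_mem]; exact v.2
  have hs : B v (ρ v) ≠ 0 := by
    intro h0
    have : ρ v ∈ Submodule.map ρ L ⊓ B.orthogonal L := by
      refine ⟨Submodule.mem_map_of_mem v.2, ?_⟩
      refine LinearMap.BilinForm.mem_orthogonal_iff.2 ?_
      intro n hn
      rw [hL] at hn
      obtain ⟨c, rfl⟩ := Submodule.mem_span_singleton.1 hn
      simp [h0]
    rw [hρ, Submodule.mem_bot] at this
    apply hv0
    have h2 := hρ2 v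
    rw [this, map_zero] at h2
    exact Subtype.ext h2.symm
  obtain ⟨z, hz⟩ := IsAlgClosed.exists_pow_nat_eq (B v (ρ v)) (n := 2) (by norm_num)
  have hz0 : z ≠ 0 := by rintro rfl; apply hs; rw [← hz]; norm_num
  refine ⟨z⁻¹ • (v : W), ?_, ?_⟩
  · exact hL.trans (Submodule.span_singleton_smul_eq (IsUnit.mk0 _ (inv_ne_zero hz0)) _).symm
  · simp only [map_smul, LinearMap.smul_apply, smul_eq_mul, ← hz]
    field_simp

/-- Nondegeneracy constant for a spanned line. -/
theorem s_ne_zero {W : Type*} [AddCommGroup W] [Module ℂ W]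
    {B : LinearMap.BilinForm ℂ W} 
    {ρ : Module.End ℂ W} (hρ2 : ∀ x, ρ (ρ x) = x)
    {L : Submodule ℂ W} {v : W} (hL : L = Submodule.span ℂ {v}) (hv0 : v ≠ 0)
    (hρ : Submodule.map ρ L ⊓ B.orthogonal L = ⊥) : B v (ρ v) ≠ 0 := by
  intro h0
  have hv : v ∈ L := by rw [hL]; exact Submodule.mem_span_singleton_self v
  have : ρ v ∈ Submodule.map ρ L ⊓ B.orthogonal L := by
    refine ⟨Submodule.mem_map_of_mem hv, ?_⟩
    refine LinearMap.BilinForm.mem_orthogonal_iff.2 ?_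
    intro n hn
    rw [hL] at hn
    obtain ⟨c, rfl⟩ := Submodule.mem_span_singleton.1 hn
    simp [h0]
  rw [hρ, Submodule.mem_bot] at this
  apply hv0
  have h2 := hρ2 v
  rw [this, map_zero] at h2
  exact h2.symm

/-- Bianchi permutability identity: with `L̂ = p_{α,Lα}(β) Lβ`, `L̃ = q_{β,Lβ}(α) Lα` and
`K = q_{β,Lβ}(0) ∘ q_{β,L̂}(0)`, one has
`p_{α,L̃}(λ) ∘ q_{β,Lβ}(λ) = K ∘ q_{β,L̂}(λ) ∘ p_{α,Lα}(λ)` for all `λ ∉ {±α, ±β}`;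
moreover `ρ K ρ = K`, so `K` preserves both eigenspaces of `ρ`. Here `Pα, Qβ, Qh, Pt`
are the families `p_{α,Lα}, q_{β,Lβ}, q_{β,L̂}, p_{α,L̃}` respectively. -/
theorem stmt12 {W : Type*} [AddCommGroup W] [Module ℂ W] [FiniteDimensional ℂ W]
    (B : LinearMap.BilinForm ℂ W) (hB : ∀ x y, B x y = B y x) (hBnd : B.Nondegenerate)
    (ρ : Module.End ℂ W) (hρ2 : ρ * ρ = 1) (hρB : ∀ x y, B (ρ x) (ρ y) = B x y)
    (α β : ℂ) (hα : α ≠ 0 ∧ α ≠ 1 ∧ α ≠ -1) (hβ : β ≠ 0 ∧ β ≠ 1 ∧ β ≠ -1)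
    (hαβ : β ≠ α ∧ β ≠ -α)
    (Lα Lβ : Submodule ℂ W)
    (hLα1 : Module.finrank ℂ Lα = 1) (hLαnull : ∀ l ∈ Lα, B l l = 0)
    (hLαρ : Submodule.map ρ Lα ⊓ B.orthogonal Lα = ⊥)
    (hLβ1 : Module.finrank ℂ Lβ = 1) (hLβnull : ∀ l ∈ Lβ, B l l = 0)
    (hLβρ : Submodule.map ρ Lβ ⊓ B.orthogonal Lβ = ⊥)
    (Pα Qβ Qh Pt : ℂ → Module.End ℂ W)
    (hPα : ∀ lam, lam ≠ α → lam ≠ -α →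
      ActsAs B ρ Lα ((α - lam) / (α + lam)) ((α + lam) / (α - lam)) (Pα lam))
    (hQβ : ∀ lam, lam ≠ β → lam ≠ -β →
      ActsAs B ρ Lβ ((lam - β) / (lam + β)) ((lam + β) / (lam - β)) (Qβ lam))
    (hLhatρ : Submodule.map ρ (Submodule.map (Pα β) Lβ)
        ⊓ B.orthogonal (Submodule.map (Pα β) Lβ) = ⊥)
    (hLtildeρ : Submodule.map ρ (Submodule.map (Qβ α) Lα)
        ⊓ B.orthogonal (Submodule.map (Qβ α) Lα) = ⊥)
    (hQh : ∀ lam, lam ≠ β → lam ≠ -β →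
      ActsAs B ρ (Submodule.map (Pα β) Lβ)
        ((lam - β) / (lam + β)) ((lam + β) / (lam - β)) (Qh lam))
    (hPt : ∀ lam, lam ≠ α → lam ≠ -α →
      ActsAs B ρ (Submodule.map (Qβ α) Lα)
        ((α - lam) / (α + lam)) ((α + lam) / (α - lam)) (Pt lam)) :
    (∀ lam, lam ≠ α → lam ≠ -α → lam ≠ β → lam ≠ -β →
      Pt lam * Qβ lam = (Qβ 0 * Qh 0) * (Qh lam * Pα lam)) ∧
    ρ * (Qβ 0 * Qh 0) * ρ = Qβ 0 * Qh 0 ∧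
    (∀ x, ρ x = x → ρ ((Qβ 0 * Qh 0) x) = (Qβ 0 * Qh 0) x) ∧
    (∀ x, ρ x = -x → ρ ((Qβ 0 * Qh 0) x) = -((Qβ 0 * Qh 0) x)) := by
  have hρρ : ∀ x, ρ (ρ x) = x := fun x => by
    have := congrArg (fun f => f x) hρ2
    simpa using this
  obtain ⟨a, ha, haa⟩ := exists_gen hρρ hLα1 hLαρ
  obtain ⟨b, hb, hbb⟩ := exists_gen hρρ hLβ1 hLβρ
  have haN : B a a = 0 := hLαnull a (by rw [ha]; exact Submodule.mem_span_singleton_self a)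
  have hbN : B b b = 0 := hLβnull b (by rw [hb]; exact Submodule.mem_span_singleton_self b)
  obtain ⟨hα0, -, -⟩ := hα
  obtain ⟨hβ0, -, -⟩ := hβ
  obtain ⟨hne1, hne2⟩ := hαβ
  have hab1 : α - β ≠ 0 := sub_ne_zero.2 (Ne.symm hne1)
  have hab2 : α + β ≠ 0 := fun h => hne2 (by linear_combination h)
  have hba1 : β - α ≠ 0 := sub_ne_zero.2 hne1
  have hne3 : α ≠ -β := fun h => hne2 (by rw [h]; ring)
  -- Gram data
  obtain ⟨u, hu⟩ : ∃ u, B a b = u := ⟨_, rfl⟩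
  obtain ⟨v, hv⟩ : ∃ v, B a (ρ b) = v := ⟨_, rfl⟩
  have hba : B b a = u := by rw [hB, hu]
  have hbra : B b (ρ a) = v := by rw [← hρB, hρρ, hB, hv]
  have hraa : B (ρ a) a = 1 := by rw [hB, haa]
  have hrbb : B (ρ b) b = 1 := by rw [hB, hbb]
  have hrab : B (ρ a) b = v := by rw [hB, hbra]
  have hrba : B (ρ b) a = v := by rw [hB, hv]
  have fP := fun lam h1 h2 => ActsAs.formula hB hρB ha haN haa one_ne_zero (hPα lam h1 h2)
  have fQ := fun lam h1 h2 => ActsAs.formula hB hρB hb hbN hbb one_ne_zero (hQβ lam h1 h2)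
  -- the transformed lines
  have hbh : Pα β b = b + (-2 * β / (α + β) * v) • a + (2 * β / (α - β) * u) • ρ a := by
    rw [fP β hne1 hne2, hbra, hba]
    match_scalars <;> field_simp <;> ring
  have hat : Qβ α a = a + (-2 * β / (α + β) * v) • b + (2 * β / (α - β) * u) • ρ b := by
    rw [fQ α (Ne.symm hne1) hne3, hv, hu]
    match_scalars <;> field_simp <;> ring
  have hLh : Submodule.map (Pα β) Lβ = Submodule.span ℂ {Pα β b} := by
    rw [hb, Submodule.map_span, Set.image_singleton]
  have hLt : Submodule.map (Qβ α) Lα = Submodule.span ℂ {Qβ α a} := by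
    rw [ha, Submodule.map_span, Set.image_singleton]
  generalize Pα β b = bh at hbh hLh
  generalize Qβ α a = at' at hat hLt
  have key : ∀ m : ℂ, ∀ y, m = -2 * β / (α + β) * y → y = -m → y = 0 := by
    intro m y h1 h2
    have : y * (α - β) = 0 := by
      have h3 : m * (α + β) = -2 * β * y := by rw [h1]; field_simp
      rw [h2] at h3 ⊢; linear_combination -h3
    exact (mul_eq_zero.1 this).resolve_right hab1
  have key2 : ∀ m : ℂ, ∀ y, m = 2 * β / (α - β) * y → y = -m → y = 0 := by
    intro m y h1 h2
    have : y * (α + β) = 0 := by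
      have h3 : m * (α - β) = 2 * β * y := by rw [h1]; field_simp
      rw [h2] at h3 ⊢; linear_combination -h3
    exact (mul_eq_zero.1 this).resolve_right hab2
  have hbh0 : bh ≠ 0 := by
    intro h0
    have h1 := congrArg (fun w => B w (ρ a)) hbh
    have h2 := congrArg (fun w => B w a) hbh
    simp only [h0, map_zero, map_add, map_smul, LinearMap.add_apply, LinearMap.smul_apply,
      LinearMap.zero_apply, smul_eq_mul, hbra, haa, hρB, haN, hba, hraa] at h1 h2
    have hv0 := key _ v rfl (by linear_combination -h1)
    have hu0 := key2 _ u rfl (by linear_combination -h2)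
    have h3 := congrArg (fun w => B w (ρ b)) hbh
    simp [h0, hv0, hu0, hbb] at h3
  have hat0 : at' ≠ 0 := by
    intro h0
    have h1 := congrArg (fun w => B w (ρ b)) hat
    have h2 := congrArg (fun w => B w b) hat
    simp only [h0, map_zero, map_add, map_smul, LinearMap.add_apply, LinearMap.smul_apply,
      LinearMap.zero_apply, smul_eq_mul, hv, hbb, hρB, hbN, hu, hrbb] at h1 h2
    have hv0 := key _ v rfl (by linear_combination -h1)
    have hu0 := key2 _ u rfl (by linear_combination -h2)
    have h3 := congrArg (fun w => B w (ρ a)) hat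
    simp [h0, hv0, hu0, haa] at h3
  have hsh := s_ne_zero hρρ hLh hbh0 hLhatρ
  have hst := s_ne_zero hρρ hLt hat0 hLtildeρ
  obtain ⟨s, hs⟩ : ∃ s, s = 1 + (2 * (-2 * β / (α + β)) + (-2 * β / (α + β)) ^ 2) * v ^ 2
    + (2 * (2 * β / (α - β)) + (2 * β / (α - β)) ^ 2) * u ^ 2 := ⟨_, rfl⟩
  have hsh1 : B bh (ρ bh) = s := by
    rw [hbh, hs]
    simp only [map_add, map_smul, LinearMap.add_apply, LinearMap.smul_apply,
      smul_eq_mul, hρρ, hρB, haa, hbb, haN, hbN, hu, hv, hba, hbra, hraa, hrbb, hrab, hrba]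
    ring
  have hst1 : B at' (ρ at') = s := by
    rw [hat, hs]
    simp only [map_add, map_smul, LinearMap.add_apply, LinearMap.smul_apply,
      smul_eq_mul, hρρ, hρB, haa, hbb, haN, hbN, hu, hv, hba, hbra, hraa, hrbb, hrab, hrba]
    ring
  have hbhN : B bh bh = 0 := by
    rw [hbh]
    simp only [map_add, map_smul, LinearMap.add_apply, LinearMap.smul_apply,
      smul_eq_mul, hρρ, hρB, haa, hbb, haN, hbN, hu, hv, hba, hbra, hraa, hrbb, hrab, hrba]
    field_simp
    ring
  have hatN : B at' at' = 0 := by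
    rw [hat]
    simp only [map_add, map_smul, LinearMap.add_apply, LinearMap.smul_apply,
      smul_eq_mul, hρρ, hρB, haa, hbb, haN, hbN, hu, hv, hba, hbra, hraa, hrbb, hrab, hrba]
    field_simp
    ring
  have hs0 : s ≠ 0 := hsh1 ▸ hsh
  have fH := fun lam h1 h2 => ActsAs.formula hB hρB hLh hbhN hsh1 hs0 (hQh lam h1 h2)
  have fT := fun lam h1 h2 => ActsAs.formula hB hρB hLt hatN hst1 hs0 (hPt lam h1 h2)
  have hβ0' : (0 : ℂ) ≠ -β := (neg_ne_zero.2 hβ0).symm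
  have fQ0 : ∀ x, Qβ 0 x = x + (-2 * B x (ρ b)) • b + (-2 * B x b) • ρ b := by
    intro x
    have e1 : (0 - β) / (0 + β) = -1 := by rw [zero_add, zero_sub, neg_div, div_self hβ0]
    have e2 : (0 + β) / (0 - β) = -1 := by rw [zero_add, zero_sub, div_neg, div_self hβ0]
    rw [fQ 0 (Ne.symm hβ0) hβ0', e1, e2]
    match_scalars <;> ring
  have fH0 : ∀ x, Qh 0 x = x + (-2 * B x (ρ bh) / s) • bh + (-2 * B x bh / s) • ρ bh := by
    intro x
    have e1 : (0 - β) / (0 + β) = -1 := by rw [zero_add, zero_sub, neg_div, div_self hβ0]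
    have e2 : (0 + β) / (0 - β) = -1 := by rw [zero_add, zero_sub, div_neg, div_self hβ0]
    rw [fH 0 (Ne.symm hβ0) hβ0', e1, e2]
    match_scalars <;> ring
  have swap : ∀ x y, B (ρ x) y = B x (ρ y) := fun x y => by rw [← hρB, hρρ]
  have cQ : ∀ x, ρ (Qβ 0 x) = Qβ 0 (ρ x) := by
    intro x
    rw [fQ0, fQ0]
    simp only [map_add, map_smul, hρρ, swap]
    module
  have cH : ∀ x, ρ (Qh 0 x) = Qh 0 (ρ x) := by
    intro x
    rw [fH0, fH0]
    simp only [map_add, map_smul, hρρ, swap]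
    module
  refine ⟨?_, ?_, ?_, ?_⟩
  · intro lam h1 h2 h3 h4
    have d1 : α - lam ≠ 0 := sub_ne_zero.2 (Ne.symm h1)
    have d2 : α + lam ≠ 0 := fun h => h2 (by linear_combination h)
    have d3 : lam - β ≠ 0 := sub_ne_zero.2 h3
    have d4 : lam + β ≠ 0 := fun h => h4 (by linear_combination h)
    have d5 : β - lam ≠ 0 := sub_ne_zero.2 (Ne.symm h3)
    have fR : ∀ x, Qh 0 (Qh lam x) = x + (-2 * lam / (lam + β) * B x (ρ bh) / s) • bh
        + (-2 * lam / (lam - β) * B x bh / s) • ρ bh := by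
      intro x
      have hsh2 : B (ρ bh) bh = s := by rw [hB, hsh1]
      rw [fH0, fH lam h3 h4]
      simp only [map_add, map_smul, LinearMap.add_apply, LinearMap.smul_apply,
        smul_eq_mul, hρB, hbhN, hsh1, hsh2]
      match_scalars <;> field_simp <;> ring
    have fP' : ∀ x, Pα lam x = x + (-2 * lam / (α + lam) * B x (ρ a)) • a
        + (2 * lam / (α - lam) * B x a) • ρ a := by
      intro x
      rw [fP lam h1 h2]
      match_scalars <;> field_simp <;> ring
    have fT' : ∀ x, Pt lam x = x + (-2 * lam / (α + lam) * B x (ρ at') / s) • at'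
        + (2 * lam / (α - lam) * B x at' / s) • ρ at' := by
      intro x
      rw [fT lam h1 h2]
      match_scalars <;> field_simp <;> ring
    have fQ' : ∀ x, Qβ lam x = x + (-2 * β / (lam + β) * B x (ρ b)) • b
        + (2 * β / (lam - β) * B x b) • ρ b := by
      intro x
      rw [fQ lam h3 h4]
      match_scalars <;> field_simp <;> ring
    ext x
    simp only [Module.End.mul_apply]
    rw [fR, fT', fQ', fQ0, fP', hbh, hat]
    simp only [map_add, map_smul, LinearMap.add_apply, LinearMap.smul_apply,
      smul_eq_mul, hρρ, hρB, haa, hbb, haN, hbN, hu, hv, hba, hbra, hraa, hrbb, hrab, hrba]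
    generalize B x a = xa
    generalize B x b = xb
    generalize B x (ρ a) = xa'
    generalize B x (ρ b) = xb'
    obtain ⟨N, hN⟩ : ∃ N, N = (α + β) ^ 2 * (α - β) ^ 2
      - 4 * α * β * (α - β) ^ 2 * v ^ 2 + 4 * α * β * (α + β) ^ 2 * u ^ 2 := ⟨_, rfl⟩
    have hs2 : s = N / ((α + β) ^ 2 * (α - β) ^ 2) := by
      rw [hs, hN]; field_simp; ring
    have hN0 : N ≠ 0 := by
      intro h; apply hs0; rw [hs2, h, zero_div]
    rw [hs2]
    clear fR fT' fQ' fQ0 fP' fP fQ fH fT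
    match_scalars
    · ring
    · field_simp
      rw [hN]
      ring
    · field_simp
      rw [hN]
      ring
    · field_simp
      rw [hN]
      ring
    · field_simp
      rw [hN]
      ring
  · ext x
    simp only [Module.End.mul_apply, cQ, cH, hρρ]
  · intro x hx
    simp only [Module.End.mul_apply, cQ, cH, hx]
  · intro x hx
    simp only [Module.End.mul_apply, cQ, cH, hx, map_neg]
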